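/- arXiv:2306.13502 — 2 statements merged into one kernel-verified Lean document; each statement's English description precedes it below -/
import Mathlib

section
/- Let K be a field, G a finite subgroup of PGL₂(K) with quotient map Q_G, and F ∈ K[x] monic and irreducible. Then there exist a monic irreducible polynomial r ∈ K[x] with deg(F) dividing deg(r) and an integer k ≥ 1 such that F^{Q_G} = (∏_{t ∈ G∗r} t)^k, i.e., F^{Q_G} is a power of the product of the distinct polynomials in the G-orbit of r. -/
open Polynomial

attribute [local instance] Classical.propDecidable

noncomputable section

variable (K : Type*) [Field K]

/-- The projective general linear group `PGL₂(K)`. -/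
abbrev PGL2 := Matrix.GeneralLinearGroup (Fin 2) K ⧸
  Subgroup.center (Matrix.GeneralLinearGroup (Fin 2) K)

variable {K}

/-- entry of a matrix in `GL₂(K)` -/
def ent (A : Matrix.GeneralLinearGroup (Fin 2) K) (i j : Fin 2) : K :=
  (A : Matrix (Fin 2) (Fin 2) K) i j

/-- `(cx+d)^n · p((ax+b)/(cx+d))`, the raw (un-normalized) transform. -/
def rawAct (A : Matrix.GeneralLinearGroup (Fin 2) K) (n : ℕ) (p : Polynomial K) :
    Polynomial K :=
  ∑ i ∈ Finset.range (n + 1),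
    C (p.coeff i) * (C (ent A 0 0) * X + C (ent A 0 1)) ^ i *
      (C (ent A 1 0) * X + C (ent A 1 1)) ^ (n - i)

/-- The normalized polynomial transformation `[A]∗f`. -/
def polyAct (A : Matrix.GeneralLinearGroup (Fin 2) K) (f : Polynomial K) : Polynomial K :=
  rawAct A f.natDegree f * C (rawAct A f.natDegree f).leadingCoeff⁻¹

/-- Möbius action of `GL₂(K)` on `K̄ ∪ {∞}`; `none` plays the role of `∞`. -/
def mob (A : Matrix.GeneralLinearGroup (Fin 2) K) :
    Option (AlgebraicClosure K) → Option (AlgebraicClosure K)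
  | none =>
      if algebraMap K (AlgebraicClosure K) (ent A 1 0) = 0 then none
      else some (algebraMap K (AlgebraicClosure K) (ent A 0 0) /
        algebraMap K (AlgebraicClosure K) (ent A 1 0))
  | some x =>
      if algebraMap K (AlgebraicClosure K) (ent A 1 0) * x +
          algebraMap K (AlgebraicClosure K) (ent A 1 1) = 0 then none
      else some ((algebraMap K (AlgebraicClosure K) (ent A 0 0) * x +
          algebraMap K (AlgebraicClosure K) (ent A 0 1)) /
        (algebraMap K (AlgebraicClosure K) (ent A 1 0) * x +
          algebraMap K (AlgebraicClosure K) (ent A 1 1)))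

/-- Möbius orbit of a point under a subgroup `G ≤ PGL₂(K)`. -/
def mobOrbit (G : Subgroup (PGL2 K)) (v : Option (AlgebraicClosure K)) :
    Set (Option (AlgebraicClosure K)) :=
  {w | ∃ A : Matrix.GeneralLinearGroup (Fin 2) K,
    (QuotientGroup.mk A : PGL2 K) ∈ G ∧ mob A v = w}

/-- Orbit of a polynomial under the normalized action of `G ≤ PGL₂(K)`. -/
def polyOrbit (G : Subgroup (PGL2 K)) (r : Polynomial K) : Set (Polynomial K) :=
  {t | ∃ A : Matrix.GeneralLinearGroup (Fin 2) K,
    (QuotientGroup.mk A : PGL2 K) ∈ G ∧ polyAct A r = t}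

/-- `f` has no roots in the Möbius `G`-orbit of `∞`. -/
def NoRootsInOrbitInfty (G : Subgroup (PGL2 K)) (f : Polynomial K) : Prop :=
  ∀ x : AlgebraicClosure K, some x ∈ mobOrbit G none → Polynomial.aeval x f ≠ 0

/-- `f` is `G`-invariant for the normalized polynomial action. -/
def GInvariant (G : Subgroup (PGL2 K)) (f : Polynomial K) : Prop :=
  ∀ A : Matrix.GeneralLinearGroup (Fin 2) K,
    (QuotientGroup.mk A : PGL2 K) ∈ G → polyAct A f = f

/-- `Q_G = g/h` is a quotient map for the finite subgroup `G ≤ PGL₂(K)`: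
a `G`-invariant reduced rational function with `g` monic and
`deg h < deg g = |G|` (equivalently, a normalized generator of `K(x)^G`). -/
structure IsQuotientMap (G : Subgroup (PGL2 K)) (g h : Polynomial K) : Prop where
  monic_g : g.Monic
  h_ne : h ≠ 0
  coprime : IsCoprime g h
  deg_lt : h.natDegree < g.natDegree
  deg_eq : g.natDegree = Nat.card G
  invariant : ∀ A : Matrix.GeneralLinearGroup (Fin 2) K,
    (QuotientGroup.mk A : PGL2 K) ∈ G →
      rawAct A g.natDegree g * h = rawAct A g.natDegree h * g

/-- The `Q`-transform `F^{g/h}(x) = h(x)^{deg F} F(g(x)/h(x))`. -/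
def Qtransform (g h F : Polynomial K) : Polynomial K :=
  ∑ i ∈ Finset.range (F.natDegree + 1), C (F.coeff i) * g ^ i * h ^ (F.natDegree - i)

/-- set of roots of `f` in the algebraic closure -/
def rootSetAC (f : Polynomial K) : Set (AlgebraicClosure K) :=
  {x | Polynomial.aeval x f = 0}

end


namespace PGL2

section Entries

variable {K : Type*} [Field K]

theorem det_ent_ne_zero (A : Matrix.GeneralLinearGroup (Fin 2) K) :
    ent A 0 0 * ent A 1 1 - ent A 0 1 * ent A 1 0 ≠ 0 := by
  have hA : (A : Matrix (Fin 2) (Fin 2) K).det ≠ 0 :=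
    ((Matrix.isUnit_iff_isUnit_det _).mp A.isUnit).ne_zero
  rwa [Matrix.det_fin_two] at hA

theorem ent_mul (A B : Matrix.GeneralLinearGroup (Fin 2) K) (i j : Fin 2) :
    ent (A * B) i j = ent A i 0 * ent B 0 j + ent A i 1 * ent B 1 j := by
  simp [ent, Matrix.mul_apply]

theorem ent_one (i j : Fin 2) :
    ent (1 : Matrix.GeneralLinearGroup (Fin 2) K) i j = if i = j then 1 else 0 := by
  simp [ent, Matrix.one_apply]

/-- Two matrices with proportional actions on a generic point agree in `PGL₂(K)`. -/
theorem mk_eq_mk_of_cross (A B : Matrix.GeneralLinearGroup (Fin 2) K)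
    (h₁ : ent A 0 0 * ent B 1 0 = ent B 0 0 * ent A 1 0)
    (h₂ : ent A 0 1 * ent B 1 1 = ent B 0 1 * ent A 1 1)
    (h₃ : ent A 0 0 * ent B 1 1 + ent A 0 1 * ent B 1 0 =
      ent B 0 0 * ent A 1 1 + ent B 0 1 * ent A 1 0) :
    (QuotientGroup.mk A : PGL2 K) = QuotientGroup.mk B := by
  rw [QuotientGroup.eq, Matrix.GeneralLinearGroup.mem_center_iff_val_mem_range_scalar]
  set D := A⁻¹ * B with hD
  have hB : B = A * D := by simp [hD]
  have hA := det_ent_ne_zero A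
  have e00 := ent_mul A D 0 0
  have e01 := ent_mul A D 0 1
  have e10 := ent_mul A D 1 0
  have e11 := ent_mul A D 1 1
  rw [← hB] at e00 e01 e10 e11
  rw [e00, e10] at h₁
  rw [e01, e11] at h₂
  rw [e00, e01, e10, e11] at h₃
  have d10 : ent D 1 0 = 0 := by
    refine (mul_eq_zero.mp ?_).resolve_left hA
    linear_combination h₁
  have d01 : ent D 0 1 = 0 := by
    refine (mul_eq_zero.mp ?_).resolve_left hA
    linear_combination -h₂
  have d11 : ent D 1 1 - ent D 0 0 = 0 := by
    refine (mul_eq_zero.mp ?_).resolve_left hA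
    linear_combination h₃
  refine ⟨ent D 0 0, ?_⟩
  ext i j
  fin_cases i <;> fin_cases j
  · simp [ent]
  · simpa [ent] using d01.symm
  · simpa [ent] using d10.symm
  · simpa [ent] using (sub_eq_zero.mp d11).symm

end Entries

section RawAct

variable {K : Type*} [Field K] (A : Matrix.GeneralLinearGroup (Fin 2) K)

theorem aeval_rawAct {S : Type*} [CommRing S] [Algebra K S] {n : ℕ} {p : K[X]}
    (hp : p.natDegree ≤ n) {y z : S}
    (hz : algebraMap K S (ent A 0 0) * y + algebraMap K S (ent A 0 1) =
      z * (algebraMap K S (ent A 1 0) * y + algebraMap K S (ent A 1 1))) :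
    aeval y (rawAct A n p) =
      (algebraMap K S (ent A 1 0) * y + algebraMap K S (ent A 1 1)) ^ n * aeval z p := by
  rw [aeval_eq_sum_range' (Nat.lt_succ_of_le hp), rawAct, map_sum, Finset.mul_sum]
  refine Finset.sum_congr rfl fun i hi => ?_
  have hi' : i + (n - i) = n := by have := Finset.mem_range.mp hi; omega
  simp only [map_mul, map_pow, map_add, aeval_C, aeval_X, hz, mul_pow, Algebra.smul_def]
  conv_rhs => rw [← hi', pow_add]
  ring

theorem aeval_rawAct_of_pole {S : Type*} [CommRing S] [Algebra K S] (n : ℕ) (p : K[X]) {y : S}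
    (hy : algebraMap K S (ent A 1 0) * y + algebraMap K S (ent A 1 1) = 0) :
    aeval y (rawAct A n p) = algebraMap K S (p.coeff n) *
      (algebraMap K S (ent A 0 0) * y + algebraMap K S (ent A 0 1)) ^ n := by
  rw [rawAct, map_sum, Finset.sum_eq_single_of_mem n (by simp)]
  · simp
  · intro i hi hin
    have : n - i ≠ 0 := by have := Finset.mem_range.mp hi; omega
    simp [hy, this]

theorem natDegree_rawAct_le (n : ℕ) (p : K[X]) : (rawAct A n p).natDegree ≤ n := by
  refine natDegree_sum_le_of_forall_le _ _ fun i hi => ?_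
  have hi' : i + (n - i) = n := by have := Finset.mem_range.mp hi; omega
  calc _ ≤ 0 + i * 1 + (n - i) * 1 := by
        refine natDegree_mul_le_of_le (natDegree_mul_le_of_le (natDegree_C _).le ?_) ?_
        · exact natDegree_pow_le_of_le _ natDegree_linear_le
        · exact natDegree_pow_le_of_le _ natDegree_linear_le
    _ = n := by omega

/-- The denominator `cY + d` does not vanish at the generic point. -/
theorem denom_ratFunc_ne_zero (E : Type*) [Field E] [Algebra K E] :
    algebraMap K (RatFunc E) (ent A 1 0) * RatFunc.X + algebraMap K (RatFunc E) (ent A 1 1) ≠ 0 := by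
  rw [IsScalarTower.algebraMap_apply K E[X] (RatFunc E),
    IsScalarTower.algebraMap_apply K E[X] (RatFunc E), ← RatFunc.algebraMap_X, ← map_mul,
    ← map_add, ne_eq, map_eq_zero_iff _ (RatFunc.algebraMap_injective E)]
  intro h0
  have hc := congrArg (fun q => q.coeff 1) h0
  have hd := congrArg (fun q => q.coeff 0) h0
  simp [Polynomial.algebraMap_apply, coeff_C] at hc hd
  exact det_ent_ne_zero A (by rw [hc, hd]; ring)

theorem aeval_X_ratFunc_injective :
    Function.Injective (aeval (RatFunc.X : RatFunc K) : K[X] →ₐ[K] RatFunc K) := by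
  intro p q hpq
  rw [RatFunc.aeval_X_left_eq_algebraMap, RatFunc.aeval_X_left_eq_algebraMap] at hpq
  exact RatFunc.algebraMap_injective K hpq

theorem rawAct_mul {m n : ℕ} {p q : K[X]} (hp : p.natDegree ≤ m) (hq : q.natDegree ≤ n) :
    rawAct A (m + n) (p * q) = rawAct A m p * rawAct A n q := by
  apply aeval_X_ratFunc_injective
  have hz := (div_mul_cancel₀ (algebraMap K (RatFunc K) (ent A 0 0) * RatFunc.X +
    algebraMap K (RatFunc K) (ent A 0 1)) (denom_ratFunc_ne_zero A K)).symm
  rw [map_mul, aeval_rawAct A (natDegree_mul_le_of_le hp hq) hz, aeval_rawAct A hp hz,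
    aeval_rawAct A hq hz, map_mul]
  ring

theorem rawAct_pow {m : ℕ} {p : K[X]} (hp : p.natDegree ≤ m) (k : ℕ) :
    rawAct A (m * k) (p ^ k) = rawAct A m p ^ k := by
  induction k with
  | zero => simp [rawAct]
  | succ k ih =>
    rw [Nat.mul_succ, pow_succ, rawAct_mul A ?_ hp, ih, pow_succ]
    rw [mul_comm]
    exact natDegree_pow_le_of_le _ hp

theorem exists_moebius_eq {E : Type*} [Field E] {a b c d u : E} (hu : c * u - a ≠ 0)
    (hdet : a * d - b * c ≠ 0) : ∃ y, a * y + b = u * (c * y + d) ∧ c * y + d ≠ 0 := by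
  obtain ⟨y, hy⟩ : ∃ y, y * (c * u - a) = b - d * u := ⟨_, div_mul_cancel₀ _ hu⟩
  refine ⟨y, by linear_combination -hy, fun h => hdet ?_⟩
  linear_combination c * hy - (c * u - a) * h

theorem rawAct_ne_zero {n : ℕ} {p : K[X]} (hp : p.natDegree ≤ n) (hp0 : p ≠ 0) :
    rawAct A n p ≠ 0 := by
  intro h0
  let E := AlgebraicClosure K
  have hA := det_ent_ne_zero A
  have hlin : C (ent A 1 0) * X - C (ent A 0 0) ≠ 0 := by
    intro h
    have hc := congrArg (fun q => q.coeff 1) h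
    have hd := congrArg (fun q => q.coeff 0) h
    simp [coeff_C] at hc hd
    exact hA (by rw [hc, hd]; ring)
  obtain ⟨u, hu⟩ : ∃ u : E, aeval u (p * (C (ent A 1 0) * X - C (ent A 0 0))) ≠ 0 := by
    by_contra! hall
    refine mul_ne_zero hp0 hlin (map_injective _ (algebraMap K E).injective ?_)
    rw [Polynomial.map_zero]
    exact funext fun u => by simpa [eval_map_algebraMap] using hall u
  rw [map_mul, mul_ne_zero_iff] at hu
  obtain ⟨hpu, hu⟩ := hu
  simp only [map_sub, map_mul, aeval_C, aeval_X] at hu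
  have hA' := (map_ne_zero (algebraMap K E)).mpr hA
  simp only [map_sub, map_mul] at hA'
  generalize ha : algebraMap K E (ent A 0 0) = a at *
  generalize hb : algebraMap K E (ent A 0 1) = b at *
  generalize hc : algebraMap K E (ent A 1 0) = c at *
  generalize hd : algebraMap K E (ent A 1 1) = d at *
  obtain ⟨y, hy, hy0⟩ := exists_moebius_eq hu hA'
  have key := aeval_rawAct A hp (S := E) (y := y) (z := u) (by rw [ha, hb, hc, hd, hy])
  rw [h0, map_zero, hc, hd] at key
  exact mul_ne_zero (pow_ne_zero _ hy0) hpu key.symm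

/-- If `z = A ∘ y` then `y = A⁻¹ ∘ z`. -/
theorem moebius_inv {E : Type*} [Field E] [Algebra K E] {y z : E}
    (hz : algebraMap K E (ent A 0 0) * y + algebraMap K E (ent A 0 1) =
      z * (algebraMap K E (ent A 1 0) * y + algebraMap K E (ent A 1 1)))
    (hy : algebraMap K E (ent A 1 0) * y + algebraMap K E (ent A 1 1) ≠ 0) :
    algebraMap K E (ent A⁻¹ 0 0) * z + algebraMap K E (ent A⁻¹ 0 1) =
      y * (algebraMap K E (ent A⁻¹ 1 0) * z + algebraMap K E (ent A⁻¹ 1 1)) := by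
  have e (i j : Fin 2) := congrArg (algebraMap K E) (ent_mul A⁻¹ A i j)
  have e00 := e 0 0
  have e01 := e 0 1
  have e10 := e 1 0
  have e11 := e 1 1
  simp only [inv_mul_cancel, map_add, map_mul, ent_one] at e00 e01 e10 e11
  simp at e00 e01 e10 e11
  refine mul_right_cancel₀ hy ?_
  linear_combination (-(algebraMap K E (ent A⁻¹ 0 0)) + y * algebraMap K E (ent A⁻¹ 1 0)) * hz -
    y * e00 - e01 + y ^ 2 * e10 + y * e11

/-- `[A]∗` sends the minimal polynomial of `A ∘ y` to the minimal polynomial of `y`. -/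
theorem polyAct_minpoly {E : Type*} [Field E] [Algebra K E] [Algebra.IsIntegral K E] {y z : E}
    (hz : algebraMap K E (ent A 0 0) * y + algebraMap K E (ent A 0 1) =
      z * (algebraMap K E (ent A 1 0) * y + algebraMap K E (ent A 1 1)))
    (hy : algebraMap K E (ent A 1 0) * y + algebraMap K E (ent A 1 1) ≠ 0) :
    polyAct A (minpoly K z) = minpoly K y := by
  have hint : ∀ x : E, IsIntegral K x := Algebra.IsIntegral.isIntegral
  have hle : ∀ (B : Matrix.GeneralLinearGroup (Fin 2) K) (y z : E),
      algebraMap K E (ent B 0 0) * y + algebraMap K E (ent B 0 1) =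
        z * (algebraMap K E (ent B 1 0) * y + algebraMap K E (ent B 1 1)) →
      minpoly K y ∣ rawAct B (minpoly K z).natDegree (minpoly K z) ∧
      (minpoly K y).natDegree ≤ (minpoly K z).natDegree := by
    intro B y z h
    have hdvd : minpoly K y ∣ rawAct B (minpoly K z).natDegree (minpoly K z) :=
      minpoly.dvd _ _ (by rw [aeval_rawAct B le_rfl h, minpoly.aeval, mul_zero])
    exact ⟨hdvd, (natDegree_le_of_dvd hdvd (rawAct_ne_zero B le_rfl (minpoly.ne_zero (hint z)))).trans
      (natDegree_rawAct_le _ _ _)⟩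
  have hinv := moebius_inv A hz hy
  have h0 := rawAct_ne_zero A le_rfl (minpoly.ne_zero (hint z))
  have hunit : IsUnit (C (rawAct A (minpoly K z).natDegree (minpoly K z)).leadingCoeff⁻¹) :=
    isUnit_C.mpr (IsUnit.mk0 _ (inv_ne_zero (leadingCoeff_ne_zero.mpr h0)))
  refine eq_of_monic_of_dvd_of_natDegree_le (minpoly.monic (hint y)) ?_
    ((hle A y z hz).1.mul_right _) ?_
  · exact monic_mul_leadingCoeff_inv h0
  · refine (natDegree_mul_C_le _ _).trans ((natDegree_rawAct_le _ _ _).trans (hle A⁻¹ z y hinv).2)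

end RawAct

section Qtransform

variable {K : Type*} [Field K] {g h F : K[X]}

theorem aeval_Qtransform {S : Type*} [CommRing S] [Algebra K S] {y w : S}
    (hw : aeval y g = w * aeval y h) :
    aeval y (Qtransform g h F) = aeval y h ^ F.natDegree * aeval w F := by
  rw [aeval_eq_sum_range (x := w), Qtransform, map_sum, Finset.mul_sum]
  refine Finset.sum_congr rfl fun i hi => ?_
  have hi' : i + (F.natDegree - i) = F.natDegree := by have := Finset.mem_range.mp hi; omega
  simp only [map_mul, map_pow, aeval_C, hw, Algebra.smul_def]
  conv_rhs => rw [← hi', pow_add]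
  ring

theorem aeval_Qtransform_of_pole {S : Type*} [CommRing S] [Algebra K S] (hF : F.Monic) {y : S}
    (hy : aeval y h = 0) : aeval y (Qtransform g h F) = aeval y g ^ F.natDegree := by
  rw [Qtransform, map_sum, Finset.sum_eq_single_of_mem F.natDegree (by simp)]
  · simp [hF.coeff_natDegree]
  · intro i hi hin
    have : F.natDegree - i ≠ 0 := by have := Finset.mem_range.mp hi; omega
    simp [hy, this]

theorem natDegree_Qtransform_le (hgh : h.natDegree ≤ g.natDegree) :
    (Qtransform g h F).natDegree ≤ g.natDegree * F.natDegree := by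
  refine natDegree_sum_le_of_forall_le _ _ fun i hi => ?_
  have hi' : i + (F.natDegree - i) = F.natDegree := by have := Finset.mem_range.mp hi; omega
  calc _ ≤ 0 + i * g.natDegree + (F.natDegree - i) * g.natDegree := by
        refine natDegree_mul_le_of_le (natDegree_mul_le_of_le (natDegree_C _).le ?_) ?_
        · exact natDegree_pow_le_of_le _ le_rfl
        · exact natDegree_pow_le_of_le _ hgh
    _ = g.natDegree * F.natDegree := by rw [zero_add, ← add_mul, hi', mul_comm]

theorem monic_Qtransform (hF : F.Monic) (hg : g.Monic) (hgh : h.natDegree < g.natDegree) :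
    (Qtransform g h F).Monic := by
  refine monic_of_natDegree_le_of_coeff_eq_one _ (natDegree_Qtransform_le hgh.le) ?_
  rw [Qtransform, finsetSum_coeff, Finset.sum_eq_single_of_mem F.natDegree (by simp)]
  · have := (hg.pow F.natDegree).coeff_natDegree
    rw [hg.natDegree_pow, mul_comm] at this
    simp [hF.coeff_natDegree, this]
  · intro i hi hin
    have hi' : i + (F.natDegree - i) = F.natDegree := by have := Finset.mem_range.mp hi; omega
    have hpos : 0 < F.natDegree - i := by have := Finset.mem_range.mp hi; omega
    refine coeff_eq_zero_of_natDegree_lt ?_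
    calc _ ≤ 0 + i * g.natDegree + (F.natDegree - i) * h.natDegree := by
          refine natDegree_mul_le_of_le (natDegree_mul_le_of_le (natDegree_C _).le ?_) ?_
          · exact natDegree_pow_le_of_le _ le_rfl
          · exact natDegree_pow_le_of_le _ le_rfl
      _ < 0 + i * g.natDegree + (F.natDegree - i) * g.natDegree := by gcongr
      _ = g.natDegree * F.natDegree := by rw [zero_add, ← add_mul, hi', mul_comm]

end Qtransform

end PGL2

namespace IsQuotientMap

open PGL2

variable {K : Type*} [Field K] {G : Subgroup (PGL2 K)} {g h F : K[X]}
  {A : Matrix.GeneralLinearGroup (Fin 2) K}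

theorem exists_rawAct_eq (hQ : IsQuotientMap G g h) (hA : (QuotientGroup.mk A : PGL2 K) ∈ G) :
    ∃ u : K, u ≠ 0 ∧ rawAct A g.natDegree g = C u * g ∧ rawAct A g.natDegree h = C u * h := by
  have hinv := hQ.invariant A hA
  have hg0 := hQ.monic_g.ne_zero
  have hgA := rawAct_ne_zero A le_rfl hg0
  obtain ⟨v, hv⟩ : g ∣ rawAct A g.natDegree g :=
    hQ.coprime.dvd_of_dvd_mul_right (hinv ▸ dvd_mul_left _ _)
  have hv0 : v ≠ 0 := by rintro rfl; exact hgA (by simpa using hv)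
  have hdeg := natDegree_rawAct_le A g.natDegree g
  rw [hv, natDegree_mul hg0 hv0] at hdeg
  obtain ⟨u, rfl⟩ : ∃ u, C u = v := natDegree_eq_zero.mp (by omega)
  refine ⟨u, by simpa using hv0, by rw [hv, mul_comm], mul_right_cancel₀ hg0 ?_⟩
  rw [← hinv, hv]
  ring

theorem denom_ne_zero (hQ : IsQuotientMap G g h) (hA : (QuotientGroup.mk A : PGL2 K) ∈ G)
    {S : Type*} [Field S] [Algebra K S] {y : S} (hy : aeval y h ≠ 0) :
    algebraMap K S (ent A 1 0) * y + algebraMap K S (ent A 1 1) ≠ 0 := by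
  intro h0
  obtain ⟨u, hu, -, hh⟩ := hQ.exists_rawAct_eq hA
  have := aeval_rawAct_of_pole A g.natDegree h h0
  rw [hh, coeff_eq_zero_of_natDegree_lt hQ.deg_lt] at this
  simp [hu, hy] at this

theorem aeval_mul_eq (hQ : IsQuotientMap G g h) (hA : (QuotientGroup.mk A : PGL2 K) ∈ G)
    {S : Type*} [Field S] [Algebra K S] {y z : S}
    (hz : algebraMap K S (ent A 0 0) * y + algebraMap K S (ent A 0 1) =
      z * (algebraMap K S (ent A 1 0) * y + algebraMap K S (ent A 1 1)))
    (hy : algebraMap K S (ent A 1 0) * y + algebraMap K S (ent A 1 1) ≠ 0) :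
    aeval z g * aeval y h = aeval z h * aeval y g := by
  obtain ⟨u, hu, hg, hh⟩ := hQ.exists_rawAct_eq hA
  have eg := aeval_rawAct A le_rfl hz (p := g)
  have eh := aeval_rawAct A hQ.deg_lt.le hz
  rw [hg, map_mul, aeval_C] at eg
  rw [hh, map_mul, aeval_C] at eh
  refine mul_left_cancel₀ (pow_ne_zero g.natDegree hy) ?_
  linear_combination -(aeval y h) * eg + aeval y g * eh

theorem exists_rawAct_Qtransform (hQ : IsQuotientMap G g h)
    (hA : (QuotientGroup.mk A : PGL2 K) ∈ G) (F : K[X]) :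
    ∃ u : K, u ≠ 0 ∧ rawAct A (g.natDegree * F.natDegree) (Qtransform g h F) =
      C u * Qtransform g h F := by
  obtain ⟨u, hu, hg, hh⟩ := hQ.exists_rawAct_eq hA
  refine ⟨u ^ F.natDegree, pow_ne_zero _ hu, aeval_X_ratFunc_injective ?_⟩
  have hz := (div_mul_cancel₀ (algebraMap K (RatFunc K) (ent A 0 0) * RatFunc.X +
    algebraMap K (RatFunc K) (ent A 0 1)) (denom_ratFunc_ne_zero A K)).symm
  rw [aeval_rawAct A (natDegree_Qtransform_le hQ.deg_lt.le) hz]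
  have eg := aeval_rawAct A le_rfl hz (p := g)
  have eh := aeval_rawAct A hQ.deg_lt.le hz
  rw [hg, map_mul, aeval_C] at eg
  rw [hh, map_mul, aeval_C] at eh
  simp only [Qtransform, map_sum, Finset.mul_sum, map_mul, map_pow, aeval_C]
  refine Finset.sum_congr rfl fun i hi => ?_
  obtain ⟨m, hm⟩ := Nat.exists_eq_add_of_le (Nat.lt_succ_iff.mp (Finset.mem_range.mp hi))
  rw [pow_mul, hm, Nat.add_sub_cancel_left]
  have e₁ := congrArg (· ^ i) eg
  have e₂ := congrArg (· ^ m) eh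
  simp only [mul_pow] at e₁ e₂
  simp only [pow_add]
  have e := congrArg₂ (· * ·) e₁ e₂
  linear_combination -(algebraMap K (RatFunc K) (F.coeff i)) * e

/-- `G` acts transitively on the fibres of its quotient map away from the poles. -/
theorem exists_moebius_of_fibre_eq (hQ : IsQuotientMap G g h) (hG : (G : Set (PGL2 K)).Finite)
    {E : Type*} [Field E] [Algebra K E] {y z : E} (hy : aeval y h ≠ 0)
    (hyz : aeval z g * aeval y h = aeval z h * aeval y g) :
    ∃ A : Matrix.GeneralLinearGroup (Fin 2) K, (QuotientGroup.mk A : PGL2 K) ∈ G ∧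
      algebraMap K E (ent A 0 0) * y + algebraMap K E (ent A 0 1) =
        z * (algebraMap K E (ent A 1 0) * y + algebraMap K E (ent A 1 1)) := by
  have : Finite G := hG
  have : Fintype G := Fintype.ofFinite G
  let M (σ : G) : Matrix.GeneralLinearGroup (Fin 2) K := Quotient.out σ.1
  have hM (σ : G) : (QuotientGroup.mk (M σ) : PGL2 K) = σ.1 := QuotientGroup.out_eq' _
  let num (σ : G) : E[X] := C (algebraMap K E (ent (M σ) 0 0)) * X + C (algebraMap K E (ent (M σ) 0 1))
  let den (σ : G) : E[X] := C (algebraMap K E (ent (M σ) 1 0)) * X + C (algebraMap K E (ent (M σ) 1 1))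
  let φ := algebraMap E[X] (RatFunc E)
  have hφ : Function.Injective φ := RatFunc.algebraMap_injective E
  have hφX : φ X = RatFunc.X := RatFunc.algebraMap_X
  have hφC (a : K) : φ (C (algebraMap K E a)) = algebraMap K (RatFunc E) a := by
    rw [IsScalarTower.algebraMap_apply K E[X] (RatFunc E)]; rfl
  have hden (σ : G) : φ (den σ) ≠ 0 := by
    simp only [den, map_add, map_mul, hφX, hφC]
    exact denom_ratFunc_ne_zero (M σ) E
  let ζ (σ : G) : RatFunc E := φ (num σ) / φ (den σ)
  have hζ : Function.Injective ζ := by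
    intro σ τ hστ
    have hcross : num σ * den τ = num τ * den σ := by
      apply hφ
      rw [map_mul, map_mul]
      exact (div_eq_div_iff (hden σ) (hden τ)).mp hστ
    have c0 := congrArg (fun q => q.coeff 0) hcross
    have c1 := congrArg (fun q => q.coeff 1) hcross
    have c2 := congrArg (fun q => q.coeff 2) hcross
    have expand (a b c d : E) : (C a * X + C b) * (C c * X + C d) =
        C (a * c) * X ^ 2 + C (a * d + b * c) * X + C (b * d) := by
      simp only [C_mul, C_add]
      ring
    simp only [num, den, expand] at c0 c1 c2
    simp [-map_mul, -map_add, coeff_X, coeff_C, coeff_C_mul, coeff_X_pow] at c0 c1 c2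
    simp only [← map_mul, ← map_add] at c0 c1 c2
    have inj := (algebraMap K E).injective
    apply Subtype.ext
    rw [← hM σ, ← hM τ]
    exact mk_eq_mk_of_cross _ _ (inj c2) (inj c0) (inj c1)
  have haeval (p : K[X]) : aeval (RatFunc.X : RatFunc E) p = φ (p.map (algebraMap K E)) := by
    rw [← hφX, aeval_algebraMap_apply, ← aeval_X_left_apply (R := E) (p.map _),
      aeval_map_algebraMap]
  have hhY : aeval (RatFunc.X : RatFunc E) h ≠ 0 := by
    rw [haeval, ne_eq, map_eq_zero_iff _ hφ, Polynomial.map_eq_zero]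
    exact hQ.h_ne
  let q := aeval (RatFunc.X : RatFunc E) g / aeval (RatFunc.X : RatFunc E) h
  let P : (RatFunc E)[X] := g.map (algebraMap K _) - C q * h.map (algebraMap K _)
  have hlt : (C q * h.map (algebraMap K (RatFunc E))).natDegree <
      (g.map (algebraMap K (RatFunc E))).natDegree := by
    refine (natDegree_C_mul_le _ _).trans_lt ?_
    simpa using hQ.deg_lt
  have hPmonic : P.Monic := (hQ.monic_g.map _).sub_of_left (degree_lt_degree hlt)
  have hPdeg : P.natDegree = Fintype.card G := by
    rw [natDegree_sub_eq_left_of_natDegree_lt hlt, natDegree_map, hQ.deg_eq,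
      Nat.card_eq_fintype_card]
  have hroot (σ : G) : P.IsRoot (ζ σ) := by
    have hσ : (QuotientGroup.mk (M σ) : PGL2 K) ∈ G := by rw [hM]; exact σ.2
    have h1 := hQ.aeval_mul_eq hσ (y := (RatFunc.X : RatFunc E)) (z := ζ σ)
      (by
        have := (div_mul_cancel₀ (φ (num σ)) (hden σ)).symm
        simpa only [ζ, num, den, map_add, map_mul, hφX, hφC] using this)
      (denom_ratFunc_ne_zero (M σ) E)
    simp only [P, IsRoot.def, eval_sub, eval_mul, eval_C, eval_map_algebraMap, q]
    field_simp
    linear_combination h1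
  have hprod : P = ∏ σ, (X - C (ζ σ)) := by
    refine eq_of_monic_of_dvd_of_natDegree_le
      (monic_prod_of_monic _ _ fun σ _ => monic_X_sub_C _) hPmonic ?_ ?_
    · refine Finset.prod_dvd_of_coprime ?_ fun σ _ => dvd_iff_isRoot.mpr (hroot σ)
      intro σ _ τ _ hne
      exact pairwise_coprime_X_sub_C hζ hne
    · rw [natDegree_prod_of_monic _ _ fun σ _ => monic_X_sub_C _, hPdeg]
      simp
  have hpoly : (∏ σ, den σ) * (C (aeval z g) * h.map (algebraMap K E) -
      C (aeval z h) * g.map (algebraMap K E)) =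
      h.map (algebraMap K E) * ∏ σ, (C z * den σ - num σ) := by
    apply hφ
    have hez (p : K[X]) : aeval (φ (C z)) p = φ (C (aeval z p)) := by
      have : φ (C z) = algebraMap E (RatFunc E) z := rfl
      rw [this, aeval_algebraMap_apply]; rfl
    have hval := congrArg (eval (φ (C z))) hprod
    simp only [P, eval_sub, eval_mul, eval_C, eval_map_algebraMap, eval_prod, eval_X, q, hez] at hval
    have hsplit : ∏ σ, (φ (C z) * φ (den σ) - φ (num σ)) =
        (∏ σ, φ (den σ)) * ∏ σ, (φ (C z) - ζ σ) := by
      rw [← Finset.prod_mul_distrib]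
      refine Finset.prod_congr rfl fun σ _ => ?_
      have := hden σ
      simp only [ζ]
      field_simp
    simp only [map_mul, map_sub, map_prod, hsplit, ← hval, ← haeval]
    field_simp
  have heval := congrArg (eval y) hpoly
  simp only [eval_mul, eval_sub, eval_C, eval_map_algebraMap, eval_prod] at heval
  rw [hyz, sub_self, mul_zero, eq_comm, mul_eq_zero_iff_left hy, Finset.prod_eq_zero_iff] at heval
  obtain ⟨σ, -, hσ⟩ := heval
  refine ⟨M σ, by rw [hM]; exact σ.2, ?_⟩
  simp [num, den] at hσ
  linear_combination -hσ

theorem aeval_h_ne_zero (hQ : IsQuotientMap G g h) {S : Type*} [Field S] [Algebra K S] {y : S}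
    (hg : aeval y h = 0 → aeval y g = 0) : aeval y h ≠ 0 := by
  intro hh
  obtain ⟨a, b, hab⟩ := hQ.coprime
  have := congrArg (aeval y) hab
  simp [hh, hg hh] at this

theorem aeval_h_ne_zero_of_root (hQ : IsQuotientMap G g h) (hF : F.Monic) {S : Type*} [Field S]
    [Algebra K S] {y : S} (hy : aeval y (Qtransform g h F) = 0) : aeval y h ≠ 0 :=
  hQ.aeval_h_ne_zero fun hh => by
    rw [aeval_Qtransform_of_pole hF hh] at hy
    exact eq_zero_of_pow_eq_zero hy

/-- Every `A ∈ G` can be inverted at a point that is not a pole of the quotient map. -/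
theorem exists_preimage (hQ : IsQuotientMap G g h) (hA : (QuotientGroup.mk A : PGL2 K) ∈ G)
    {E : Type*} [Field E] [Algebra K E] {z : E} (hz : aeval z h ≠ 0) :
    ∃ y : E, algebraMap K E (ent A 0 0) * y + algebraMap K E (ent A 0 1) =
        z * (algebraMap K E (ent A 1 0) * y + algebraMap K E (ent A 1 1)) ∧
      algebraMap K E (ent A 1 0) * y + algebraMap K E (ent A 1 1) ≠ 0 := by
  have hdet := (map_ne_zero (algebraMap K E)).mpr (det_ent_ne_zero A)
  simp only [map_sub, map_mul] at hdet
  refine exists_moebius_eq (fun h0 => ?_) hdet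
  have hinv : (QuotientGroup.mk A⁻¹ : PGL2 K) ∈ G := G.inv_mem hA
  have hden := hQ.denom_ne_zero hinv hz
  have e := congrArg (algebraMap K E) (ent_mul A⁻¹ A 1 0)
  simp only [inv_mul_cancel, map_add, map_mul, ent_one] at e
  simp at e
  have hc : algebraMap K E (ent A 1 0) = 0 := by
    refine (mul_eq_zero.mp ?_).resolve_right hden
    linear_combination algebraMap K E (ent A⁻¹ 1 0) * h0 - e
  exact hdet (by linear_combination -algebraMap K E (ent A 1 1) * h0 +
    (algebraMap K E (ent A 1 1) * z - algebraMap K E (ent A 0 1)) * hc)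

theorem aeval_Qtransform_eq_zero (hQ : IsQuotientMap G g h)
    (hA : (QuotientGroup.mk A : PGL2 K) ∈ G) {E : Type*} [Field E] [Algebra K E] {y z : E}
    (hyz : algebraMap K E (ent A 0 0) * y + algebraMap K E (ent A 0 1) =
        z * (algebraMap K E (ent A 1 0) * y + algebraMap K E (ent A 1 1)))
    (hz : aeval z (Qtransform g h F) = 0) : aeval y (Qtransform g h F) = 0 := by
  obtain ⟨u, hu, hP⟩ := hQ.exists_rawAct_Qtransform hA F
  have := aeval_rawAct A (natDegree_Qtransform_le (F := F) hQ.deg_lt.le) hyz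
  rw [hP, hz, mul_zero, map_mul, aeval_C] at this
  exact (mul_eq_zero.mp this).resolve_left ((_root_.map_ne_zero _).mpr hu)

theorem minpoly_pow_dvd (hQ : IsQuotientMap G g h) (hF : F.Monic)
    (hA : (QuotientGroup.mk A : PGL2 K) ∈ G) {E : Type*} [Field E] [Algebra K E] {y z : E}
    (hyz : algebraMap K E (ent A 0 0) * y + algebraMap K E (ent A 0 1) =
        z * (algebraMap K E (ent A 1 0) * y + algebraMap K E (ent A 1 1)))
    {k : ℕ} (hk : minpoly K z ^ k ∣ Qtransform g h F) :
    minpoly K y ^ k ∣ Qtransform g h F := by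
  obtain ⟨u, hu, hP⟩ := hQ.exists_rawAct_Qtransform hA F
  have hdeg := natDegree_Qtransform_le (F := F) hQ.deg_lt.le
  have hP0 := (monic_Qtransform hF hQ.monic_g hQ.deg_lt).ne_zero
  have hunit : IsUnit (C u) := isUnit_C.mpr hu.isUnit
  rw [← hunit.dvd_mul_left, ← hP]
  obtain ⟨m, hm⟩ := hk
  rw [hm] at hdeg hP0 ⊢
  rw [natDegree_mul (left_ne_zero_of_mul hP0) (right_ne_zero_of_mul hP0), natDegree_pow] at hdeg
  obtain ⟨l, hl⟩ := Nat.exists_eq_add_of_le (le_self_add.trans hdeg)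
  rw [hl, rawAct_mul A (natDegree_pow _ _).le (by omega), mul_comm k, rawAct_pow A le_rfl]
  refine Dvd.dvd.mul_right (pow_dvd_pow_of_dvd (minpoly.dvd _ _ ?_) k) _
  rw [aeval_rawAct A le_rfl hyz, minpoly.aeval, mul_zero]

end IsQuotientMap

open PGL2 UniqueFactorizationMonoid in
/-- The orbit of `minpoly K z` consists of the monic irreducible factors of the `Q`-transform. -/
theorem IsQuotientMap.polyOrbit_minpoly {K : Type*} [Field K] {G : Subgroup (PGL2 K)}
    (hG : (G : Set (PGL2 K)).Finite) {g h F : K[X]} (hQ : IsQuotientMap G g h)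
    (hF : F.Monic) (hFirr : Irreducible F) {z : AlgebraicClosure K}
    (hz : aeval z (Qtransform g h F) = 0) :
    polyOrbit G (minpoly K z) = {s | s ∈ normalizedFactors (Qtransform g h F)} ∧
      ∀ s ∈ normalizedFactors (Qtransform g h F),
        (normalizedFactors (Qtransform g h F)).count s =
          (normalizedFactors (Qtransform g h F)).count (minpoly K z) := by
  set P := Qtransform g h F with hPdef
  have hP0 : P ≠ 0 := (monic_Qtransform hF hQ.monic_g hQ.deg_lt).ne_zero
  have hint (x : AlgebraicClosure K) : IsIntegral K x := Algebra.IsIntegral.isIntegral x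
  have hmem {y : AlgebraicClosure K} (hy : aeval y P = 0) :
      minpoly K y ∈ normalizedFactors P :=
    (mem_normalizedFactors_iff' hP0).mpr ⟨minpoly.irreducible (hint y),
      (minpoly.monic (hint y)).normalize_eq_self, minpoly.dvd _ _ hy⟩
  have hcount (p : K[X]) (hp : p ∈ normalizedFactors P) (k : ℕ) :
      p ^ k ∣ P ↔ k ≤ (normalizedFactors P).count p := by
    have hp' := (mem_normalizedFactors_iff' hP0).mp hp
    rw [pow_dvd_iff_le_emultiplicity, emultiplicity_eq_count_normalizedFactors hp'.1 hP0, hp'.2.1,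
      Nat.cast_le]
  have hhz := hQ.aeval_h_ne_zero_of_root hF hz
  have hfib {y : AlgebraicClosure K} (hy : aeval y P = 0) :
      aeval (aeval y g / aeval y h) F = 0 := by
    have hhy := hQ.aeval_h_ne_zero_of_root hF hy
    rw [hPdef, aeval_Qtransform (div_mul_cancel₀ _ hhy).symm] at hy
    exact (mul_eq_zero.mp hy).resolve_left (pow_ne_zero _ hhy)
  have htrans (s : K[X]) (hs : s ∈ normalizedFactors P) :
      ∃ (A : Matrix.GeneralLinearGroup (Fin 2) K) (y : AlgebraicClosure K),
        (QuotientGroup.mk A : PGL2 K) ∈ G ∧ minpoly K y = s ∧ aeval y P = 0 ∧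
        algebraMap K _ (ent A 0 0) * y + algebraMap K _ (ent A 0 1) =
          z * (algebraMap K _ (ent A 1 0) * y + algebraMap K _ (ent A 1 1)) := by
    obtain ⟨hsirr, hsn, hsdvd⟩ := (mem_normalizedFactors_iff' hP0).mp hs
    have hsm : s.Monic := hsn ▸ monic_normalize hsirr.ne_zero
    obtain ⟨x, hx⟩ := IsAlgClosed.exists_aeval_eq_zero (AlgebraicClosure K) s
      (degree_pos_of_irreducible hsirr).ne'
    have hxP : aeval x P = 0 := aeval_eq_zero_of_dvd_aeval_eq_zero hsdvd hx
    have hconj : IsConjRoot K (aeval z g / aeval z h) (aeval x g / aeval x h) :=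
      (minpoly.eq_of_irreducible_of_monic hFirr (hfib hz) hF).symm.trans
        (minpoly.eq_of_irreducible_of_monic hFirr (hfib hxP) hF)
    obtain ⟨τ, hτ⟩ := hconj.exists_algEquiv
    have hyP : aeval (τ x) P = 0 := by rw [aeval_algHom_apply, hxP, map_zero]
    have hhy := hQ.aeval_h_ne_zero_of_root hF hyP
    obtain ⟨A, hA, hyz⟩ := hQ.exists_moebius_of_fibre_eq hG (y := τ x) (z := z) hhy (by
      rw [map_div₀, ← aeval_algHom_apply, ← aeval_algHom_apply, div_eq_div_iff hhy hhz] at hτ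
      linear_combination -hτ)
    refine ⟨A, τ x, hA, ?_, hyP, hyz⟩
    rw [minpoly.algEquiv_eq, minpoly.eq_of_irreducible_of_monic hsirr hx hsm]
  refine ⟨Set.ext fun s => ⟨?_, fun hs => ?_⟩, fun s hs => ?_⟩
  · rintro ⟨A, hA, rfl⟩
    obtain ⟨y, hyz, hy⟩ := hQ.exists_preimage hA hhz
    rw [polyAct_minpoly A hyz hy]
    exact hmem (hQ.aeval_Qtransform_eq_zero hA hyz hz)
  · obtain ⟨A, y, hA, rfl, hyP, hyz⟩ := htrans s hs
    exact ⟨A, hA, polyAct_minpoly A hyz (hQ.denom_ne_zero hA (hQ.aeval_h_ne_zero_of_root hF hyP))⟩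
  · obtain ⟨A, y, hA, rfl, hyP, hyz⟩ := htrans s hs
    have hy := hQ.denom_ne_zero hA (hQ.aeval_h_ne_zero_of_root hF hyP)
    refine le_antisymm ?_ ?_
    · rw [← hcount _ (hmem hz)]
      exact hQ.minpoly_pow_dvd hF (G.inv_mem hA) (moebius_inv A hyz hy) ((hcount _ hs _).mpr le_rfl)
    · rw [← hcount _ hs]
      exact hQ.minpoly_pow_dvd hF hA hyz ((hcount _ (hmem hz) _).mpr le_rfl)

theorem main_theorem {K : Type*} [Field K] (G : Subgroup (PGL2 K))
    (hGfin : (G : Set (PGL2 K)).Finite) (g h : Polynomial K) (hQ : IsQuotientMap G g h)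
    (F : Polynomial K) (hF : F.Monic) (hFirr : Irreducible F) :
    ∃ (r : Polynomial K) (k : ℕ) (hfin : (polyOrbit G r).Finite),
      r.Monic ∧ Irreducible r ∧ F.natDegree ∣ r.natDegree ∧ 1 ≤ k ∧
        Qtransform g h F = (∏ t ∈ hfin.toFinset, t) ^ k := by
  obtain ⟨β, hβ⟩ := IsAlgClosed.exists_aeval_eq_zero (AlgebraicClosure K) F
    (degree_pos_of_irreducible hFirr).ne'
  obtain ⟨z, hz⟩ : ∃ z : AlgebraicClosure K, aeval z g = β * aeval z h := by
    have hlt : (C β * h.map (algebraMap K (AlgebraicClosure K))).natDegree <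
        (g.map (algebraMap K (AlgebraicClosure K))).natDegree :=
      (natDegree_C_mul_le _ _).trans_lt (by simpa only [natDegree_map] using hQ.deg_lt)
    obtain ⟨z, hz⟩ := IsAlgClosed.exists_root
      (g.map (algebraMap K (AlgebraicClosure K)) - C β * h.map (algebraMap K (AlgebraicClosure K)))
      (natDegree_pos_iff_degree_pos.mp
        (by rw [natDegree_sub_eq_left_of_natDegree_lt hlt]; omega)).ne'
    refine ⟨z, ?_⟩
    simpa [IsRoot.def, eval_map_algebraMap, sub_eq_zero] using hz
  have hhz : aeval z h ≠ 0 := hQ.aeval_h_ne_zero fun h0 => by rw [hz, h0, mul_zero]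
  have hzP : aeval z (Qtransform g h F) = 0 := by
    rw [PGL2.aeval_Qtransform hz, hβ, mul_zero]
  have hP := PGL2.monic_Qtransform hF hQ.monic_g hQ.deg_lt
  have hint (x : AlgebraicClosure K) : IsIntegral K x := Algebra.IsIntegral.isIntegral x
  obtain ⟨horb, hcount⟩ := hQ.polyOrbit_minpoly hGfin hF hFirr hzP
  set N := UniqueFactorizationMonoid.normalizedFactors (Qtransform g h F) with hN
  have hr : minpoly K z ∈ N := (UniqueFactorizationMonoid.mem_normalizedFactors_iff' hP.ne_zero).mpr
    ⟨minpoly.irreducible (hint z), (minpoly.monic (hint z)).normalize_eq_self,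
      minpoly.dvd _ _ hzP⟩
  have hset : polyOrbit G (minpoly K z) = N.toFinset := by
    rw [horb]
    ext s
    simp
  have hfin : (polyOrbit G (minpoly K z)).Finite := hset ▸ N.toFinset.finite_toSet
  refine ⟨minpoly K z, N.count (minpoly K z), hfin, minpoly.monic (hint z),
    minpoly.irreducible (hint z), ?_, Multiset.one_le_count_iff_mem.mpr hr, ?_⟩
  · rw [minpoly.eq_of_irreducible_of_monic hFirr hβ hF,
      ← IntermediateField.adjoin.finrank (hint β), ← IntermediateField.adjoin.finrank (hint z)]
    refine IntermediateField.finrank_dvd_of_le_right (IntermediateField.adjoin_simple_le_iff.mpr ?_)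
    have hβz : β = aeval z g / aeval z h := by rw [hz, mul_div_cancel_right₀ _ hhz]
    have hmem (p : K[X]) : aeval z p ∈ IntermediateField.adjoin K {z} :=
      IntermediateField.algebra_adjoin_le_adjoin K {z} (aeval_mem_adjoin_singleton K z)
    rw [hβz]
    exact div_mem (hmem g) (hmem h)
  · have hfinset : hfin.toFinset = N.toFinset := by
      ext s
      rw [Set.Finite.mem_toFinset, hset, Finset.mem_coe]
    have hNsmul : N = N.count (minpoly K z) • N.dedup := by
      ext s
      rw [Multiset.count_nsmul, Multiset.count_dedup]
      split_ifs with hs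
      · rw [hcount s hs, mul_one]
      · rw [Multiset.count_eq_zero_of_notMem hs, mul_zero]
    have hprod : N.prod = Qtransform g h F := by
      rw [hN, UniqueFactorizationMonoid.prod_normalizedFactors_eq hP.ne_zero, hP.normalize_eq_self]
    rw [hfinset, ← hprod, Finset.prod, Multiset.toFinset_val, Multiset.map_id', ← Multiset.prod_nsmul,
      ← hNsmul]
end

section
/- Let K be a field, G a finite subgroup of PGL₂(K) with quotient map Q_G, and F ∈ K[x] monic irreducible. Then all G-orbits (under Möbius transformation) contained in the set of roots of F^{Q_G} have the same cardinality; consequently |R_{F^{Q_G}}| = |R_F| · |G∘v| for any root v of F^{Q_G}. -/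
open Polynomial

attribute [local instance] Classical.propDecidable

section PolynomialLemmas

variable {L : Type*} [Field L]

/-- A monic polynomial of degree `n` with `n` distinct roots is the product of the corresponding
linear factors. -/
theorem Polynomial.Monic.eq_prod_X_sub_C_of_injective {ι : Type*} [Fintype ι] {p : L[X]}
    (hp : p.Monic) (hdeg : p.natDegree = Fintype.card ι) {s : ι → L}
    (hs : Function.Injective s) (hroot : ∀ i, p.IsRoot (s i)) :
    p = ∏ i, (X - C (s i)) := by
  refine eq_of_monic_of_dvd_of_natDegree_le (monic_prod_of_monic _ _ fun i _ => monic_X_sub_C _) hp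
    ?_ ?_
  · exact Finset.prod_dvd_of_coprime (fun i _ j _ hij => pairwise_coprime_X_sub_C hs hij)
      fun i _ => dvd_iff_isRoot.2 (hroot i)
  · rw [natDegree_prod_of_monic _ _ fun i _ => monic_X_sub_C _]
    simp [hdeg]

/-- A polynomial over an infinite field vanishing wherever a nonzero polynomial does not vanish
is zero. -/
theorem Polynomial.eq_zero_of_eval_eq_zero_of_eval_ne_zero [Infinite L] {p q : L[X]} (hq : q ≠ 0)
    (h : ∀ x, q.eval x ≠ 0 → p.eval x = 0) : p = 0 := by
  have hqp : q * p = 0 := by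
    refine Polynomial.funext fun x => ?_
    by_cases hx : q.eval x = 0
    · simp [hx]
    · simp [h x hx]
  exact (mul_eq_zero.1 hqp).resolve_left hq

end PolynomialLemmas

section Moebius

variable {K : Type*} [Field K]

/-- The numerator polynomial of the Möbius transformation of `A`. -/
noncomputable def mobNum (A : Matrix.GeneralLinearGroup (Fin 2) K) : K[X] :=
  C (ent A 0 0) * X + C (ent A 0 1)

/-- The denominator polynomial of the Möbius transformation of `A`. -/
noncomputable def mobDen (A : Matrix.GeneralLinearGroup (Fin 2) K) : K[X] :=
  C (ent A 1 0) * X + C (ent A 1 1)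

theorem mob_some (A : Matrix.GeneralLinearGroup (Fin 2) K) (x : AlgebraicClosure K) :
    mob A (some x) =
      if aeval x (mobDen A) = 0 then none else some (aeval x (mobNum A) / aeval x (mobDen A)) := by
  simp [mob, mobNum, mobDen]

theorem ent_det_ne_zero (A : Matrix.GeneralLinearGroup (Fin 2) K) :
    ent A 0 0 * ent A 1 1 - ent A 0 1 * ent A 1 0 ≠ 0 := by
  have h := (Matrix.isUnit_iff_isUnit_det _).1 A.isUnit
  rw [Matrix.det_fin_two] at h
  exact h.ne_zero

theorem isCoprime_mobNum_mobDen (A : Matrix.GeneralLinearGroup (Fin 2) K) :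
    IsCoprime (mobNum A) (mobDen A) := by
  have hdet := ent_det_ne_zero A
  set δ := ent A 0 0 * ent A 1 1 - ent A 0 1 * ent A 1 0 with hδ
  refine ⟨C (-(δ⁻¹ * ent A 1 0)), C (δ⁻¹ * ent A 0 0), ?_⟩
  have h1 : C (δ⁻¹ * δ) = (1 : K[X]) := by rw [inv_mul_cancel₀ hdet, C_1]
  rw [← h1]
  nth_rw 4 [hδ]
  simp only [mobNum, mobDen, C_mul, C_neg, C_sub]
  ring

theorem aeval_rawAct {L : Type*} [Field L] [Algebra K L]
    (A : Matrix.GeneralLinearGroup (Fin 2) K) {n : ℕ} {p : K[X]} (hp : p.natDegree ≤ n) {x : L}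
    (hx : aeval x (mobDen A) ≠ 0) :
    aeval x (rawAct A n p) =
      aeval x (mobDen A) ^ n * aeval (aeval x (mobNum A) / aeval x (mobDen A)) p := by
  rw [aeval_eq_sum_range' (Nat.lt_succ_of_le hp), Finset.mul_sum, rawAct, map_sum]
  refine Finset.sum_congr rfl fun i hi => ?_
  have hi' : i ≤ n := Nat.lt_succ_iff.1 (Finset.mem_range.1 hi)
  rw [map_mul, map_mul, map_pow, map_pow, aeval_C, Algebra.smul_def, ← mobNum, ← mobDen, div_pow,
    ← Nat.sub_add_cancel hi', pow_add, Nat.add_sub_cancel]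
  field_simp

theorem aeval_rawAct_of_mobDen_eq_zero {L : Type*} [Field L] [Algebra K L]
    (A : Matrix.GeneralLinearGroup (Fin 2) K) (n : ℕ) (p : K[X]) {x : L}
    (hx : aeval x (mobDen A) = 0) :
    aeval x (rawAct A n p) = algebraMap K L (p.coeff n) * aeval x (mobNum A) ^ n := by
  rw [rawAct, map_sum, Finset.sum_eq_single_of_mem n (Finset.self_mem_range_succ n)]
  · simp [mobNum]
  · intro i hi hin
    have hi' : n - i ≠ 0 := by have := Finset.mem_range.1 hi; omega
    rw [map_mul, map_pow _ (C (ent A 1 0) * X + C (ent A 1 1)), ← mobDen, hx, zero_pow hi',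
      mul_zero]

/-- Matrices with distinct classes in `PGL₂(K)` have distinct Möbius transformations. -/
theorem mobNum_mul_mobDen_sub_ne_zero {A B : Matrix.GeneralLinearGroup (Fin 2) K}
    (hAB : (QuotientGroup.mk A : PGL2 K) ≠ QuotientGroup.mk B) :
    mobNum A * mobDen B - mobNum B * mobDen A ≠ 0 := by
  contrapose! hAB
  have hexp : mobNum A * mobDen B - mobNum B * mobDen A =
      C (ent A 0 0 * ent B 1 0 - ent B 0 0 * ent A 1 0) * X ^ 2 +
      C (ent A 0 0 * ent B 1 1 + ent A 0 1 * ent B 1 0 -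
        (ent B 0 0 * ent A 1 1 + ent B 0 1 * ent A 1 0)) * X +
      C (ent A 0 1 * ent B 1 1 - ent B 0 1 * ent A 1 1) := by
    simp only [mobNum, mobDen, C_mul, C_sub, C_add]
    ring
  rw [hexp] at hAB
  have h0 := congrArg (coeff · 0) hAB
  have h1 := congrArg (coeff · 1) hAB
  have h2 := congrArg (coeff · 2) hAB
  simp [coeff_X, coeff_C] at h0 h1 h2
  rw [QuotientGroup.eq, Matrix.GeneralLinearGroup.mem_center_iff_val_mem_range_scalar]
  have hdet := ent_det_ne_zero A
  refine ⟨(ent A 1 1 * ent B 0 0 - ent A 0 1 * ent B 1 0) /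
    (ent A 0 0 * ent A 1 1 - ent A 0 1 * ent A 1 0), ?_⟩
  rw [Units.val_mul]
  have hinv : ((A⁻¹ : Matrix.GeneralLinearGroup (Fin 2) K) : Matrix (Fin 2) (Fin 2) K) *
      (A : Matrix (Fin 2) (Fin 2) K) = 1 := by
    rw [← Units.val_mul, inv_mul_cancel, Units.val_one]
  rw [← mul_one (Matrix.scalar _ _), ← hinv, Matrix.scalar_apply, ← Matrix.smul_eq_diagonal_mul,
    ← Matrix.mul_smul]
  congr 1
  ext i j
  rw [Matrix.smul_apply, smul_eq_mul, div_mul_eq_mul_div, div_eq_iff hdet]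
  fin_cases i <;> fin_cases j <;> simp only [ent] at * <;> simp <;> grind

end Moebius

namespace IsQuotientMap

variable {K : Type*} [Field K] {G : Subgroup (PGL2 K)} {g h : K[X]}

theorem invariant_aeval (hQ : IsQuotientMap G g h) {L : Type*} [Field L] [Algebra K L]
    {A : Matrix.GeneralLinearGroup (Fin 2) K} (hA : (QuotientGroup.mk A : PGL2 K) ∈ G) {x : L}
    (hx : aeval x (mobDen A) ≠ 0) :
    aeval (aeval x (mobNum A) / aeval x (mobDen A)) g * aeval x h =
      aeval (aeval x (mobNum A) / aeval x (mobDen A)) h * aeval x g := by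
  have hinv := congrArg (aeval x) (hQ.invariant A hA)
  rw [map_mul, map_mul, aeval_rawAct A le_rfl hx, aeval_rawAct A hQ.deg_lt.le hx, mul_assoc,
    mul_assoc] at hinv
  exact mul_left_cancel₀ (pow_ne_zero _ hx) hinv

theorem aeval_mobDen_ne_zero (hQ : IsQuotientMap G g h) {L : Type*} [Field L] [Algebra K L]
    {A : Matrix.GeneralLinearGroup (Fin 2) K} (hA : (QuotientGroup.mk A : PGL2 K) ∈ G) {x : L}
    (hx : aeval x h ≠ 0) : aeval x (mobDen A) ≠ 0 := by
  intro hden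
  have hinv := congrArg (aeval x) (hQ.invariant A hA)
  rw [map_mul, map_mul, aeval_rawAct_of_mobDen_eq_zero A _ _ hden,
    aeval_rawAct_of_mobDen_eq_zero A _ _ hden, coeff_eq_zero_of_natDegree_lt hQ.deg_lt,
    hQ.monic_g.coeff_natDegree, map_zero, map_one, one_mul, zero_mul, zero_mul] at hinv
  have hnum : aeval x (mobNum A) = 0 :=
    eq_zero_of_pow_eq_zero ((mul_eq_zero.1 hinv).resolve_right hx)
  obtain ⟨u, w, huw⟩ := isCoprime_mobNum_mobDen A
  simpa [hnum, hden] using congrArg (aeval x) huw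

theorem aeval_denom_ne_zero (hQ : IsQuotientMap G g h) {L : Type*} [Field L] [Algebra K L] (x : L)
    (hg : aeval x g = 0) : aeval x h ≠ 0 := by
  intro hh
  obtain ⟨u, w, huw⟩ := hQ.coprime
  simpa [hg, hh] using congrArg (aeval x) huw

/-- The polynomial `g - αh`, whose roots form the fibre of `g / h` over `α`, is monic. -/
theorem monic_sub (hQ : IsQuotientMap G g h) {L : Type*} [Field L] [Algebra K L] (α : L) :
    (g.map (algebraMap K L) - C α * h.map (algebraMap K L)).Monic := by
  refine (hQ.monic_g.map _).sub_of_left ?_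
  rw [← smul_eq_C_mul]
  refine (degree_smul_le _ _).trans_lt ?_
  rw [degree_map, degree_map]
  exact degree_lt_degree hQ.deg_lt

theorem natDegree_sub (hQ : IsQuotientMap G g h) {L : Type*} [Field L] [Algebra K L] (α : L) :
    (g.map (algebraMap K L) - C α * h.map (algebraMap K L)).natDegree = Nat.card G := by
  rw [natDegree_sub_eq_left_of_natDegree_lt, natDegree_map, hQ.deg_eq]
  refine (natDegree_C_mul_le _ _).trans_lt ?_
  rw [natDegree_map, natDegree_map]
  exact hQ.deg_lt

/-- The fibre of `g / h` through a point with `|G|` distinct images under `G` consists of these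
images, each with multiplicity one. -/
theorem sub_eq_prod_of_injective (hQ : IsQuotientMap G g h) [Fintype G] {L : Type*} [Field L]
    [Algebra K L] {x : L} (hx : aeval x h ≠ 0)
    (hinj : Function.Injective fun σ : G =>
      aeval x (mobNum σ.1.out) / aeval x (mobDen σ.1.out)) :
    g.map (algebraMap K L) - C (aeval x g / aeval x h) * h.map (algebraMap K L) =
      ∏ σ : G, (X - C (aeval x (mobNum σ.1.out) / aeval x (mobDen σ.1.out))) := by
  refine (hQ.monic_sub _).eq_prod_X_sub_C_of_injective
    (by rw [hQ.natDegree_sub, Nat.card_eq_fintype_card]) hinj fun σ => ?_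
  have hσ : (QuotientGroup.mk σ.1.out : PGL2 K) ∈ G := by
    rw [QuotientGroup.out_eq']; exact σ.2
  have hinv := hQ.invariant_aeval hσ (hQ.aeval_mobDen_ne_zero hσ hx)
  simp only [IsRoot, eval_sub, eval_mul, eval_C, eval_map_algebraMap]
  field_simp
  linear_combination hinv

/-- The polynomial identity, in `x`, expressing that the fibre of `g / h` through `x` is the
`G`-orbit of `x`. -/
theorem prod_mul_sub_eq (hQ : IsQuotientMap G g h) [Fintype G] {L : Type*} [Field L] [Infinite L]
    [Algebra K L] (x t : L) :
    (∏ σ : G, aeval x (mobDen σ.1.out)) * (aeval t g * aeval x h - aeval x g * aeval t h) =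
      aeval x h * ∏ σ : G, (t * aeval x (mobDen σ.1.out) - aeval x (mobNum σ.1.out)) := by
  classical
  let φ : K[X] →+* L[X] := mapRingHom (algebraMap K L)
  have hφ (p : K[X]) (y : L) : (φ p).eval y = aeval y p := by simp [φ]
  let P : L[X] := (∏ σ : G, φ (mobDen σ.1.out)) * (C (aeval t g) * φ h - φ g * C (aeval t h)) -
      φ h * ∏ σ : G, (C t * φ (mobDen σ.1.out) - φ (mobNum σ.1.out))
  have hP (y : L) : P.eval y =
      (∏ σ : G, aeval y (mobDen σ.1.out)) * (aeval t g * aeval y h - aeval y g * aeval t h) -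
      aeval y h * ∏ σ : G, (t * aeval y (mobDen σ.1.out) - aeval y (mobNum σ.1.out)) := by
    simp [P, eval_prod, hφ]
  let N : K[X] := h * ∏ p ∈ (Finset.univ : Finset G).offDiag,
      (mobNum p.1.1.out * mobDen p.2.1.out - mobNum p.2.1.out * mobDen p.1.1.out)
  have hN : N ≠ 0 := by
    refine mul_ne_zero hQ.h_ne (Finset.prod_ne_zero_iff.2 fun p hp => ?_)
    refine mobNum_mul_mobDen_sub_ne_zero ?_
    rw [QuotientGroup.out_eq', QuotientGroup.out_eq']
    exact fun he => (Finset.mem_offDiag.1 hp).2.2 (Subtype.ext he)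
  have hP0 : P = 0 := by
    refine eq_zero_of_eval_eq_zero_of_eval_ne_zero (q := φ N)
      ((Polynomial.map_ne_zero_iff (algebraMap K L).injective).2 hN) fun y hy => ?_
    rw [hφ, map_mul, mul_ne_zero_iff, map_prod, Finset.prod_ne_zero_iff] at hy
    obtain ⟨hyh, hyN⟩ := hy
    have hden (σ : G) : aeval y (mobDen σ.1.out) ≠ 0 :=
      hQ.aeval_mobDen_ne_zero (by rw [QuotientGroup.out_eq']; exact σ.2) hyh
    have hinj : Function.Injective fun σ : G =>
        aeval y (mobNum σ.1.out) / aeval y (mobDen σ.1.out) := by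
      intro σ τ hστ
      by_contra hne
      refine hyN (σ, τ) (by simpa using hne) ?_
      simpa [sub_eq_zero] using (div_eq_div_iff (hden σ) (hden τ)).1 hστ
    have key := congrArg (eval t) (hQ.sub_eq_prod_of_injective hyh hinj)
    simp only [eval_sub, eval_mul, eval_C, eval_map_algebraMap, eval_prod, eval_X] at key
    have hprod : ∏ σ : G, (t * aeval y (mobDen σ.1.out) - aeval y (mobNum σ.1.out)) =
        (∏ σ : G, aeval y (mobDen σ.1.out)) *
          ∏ σ : G, (t - aeval y (mobNum σ.1.out) / aeval y (mobDen σ.1.out)) := by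
      rw [← Finset.prod_mul_distrib]
      refine Finset.prod_congr rfl fun σ _ => ?_
      have := hden σ
      field_simp
    rw [hP, hprod, ← key]
    field_simp
    ring
  have := hP x
  rw [hP0, eval_zero] at this
  exact (sub_eq_zero.1 this.symm)

/-- The `G`-orbit of a point which is not a pole of `g / h` is the fibre of `g / h` through it. -/
theorem mobOrbit_some_eq (hQ : IsQuotientMap G g h) [Finite G] {x : AlgebraicClosure K}
    (hx : aeval x h ≠ 0) :
    mobOrbit G (some x) = some '' {y | aeval y g = aeval x g / aeval x h * aeval y h} := by
  have := Fintype.ofFinite G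
  ext w
  constructor
  · rintro ⟨A, hA, rfl⟩
    have hden := hQ.aeval_mobDen_ne_zero hA hx
    rw [mob_some, if_neg hden]
    refine ⟨_, ?_, rfl⟩
    have hinv := hQ.invariant_aeval hA hden
    rw [Set.mem_ofPred_eq, div_mul_eq_mul_div, eq_div_iff hx, hinv, mul_comm]
  · rintro ⟨y, hy, rfl⟩
    rw [Set.mem_ofPred_eq, div_mul_eq_mul_div, eq_div_iff hx] at hy
    have hprod := hQ.prod_mul_sub_eq x y
    rw [hy, sub_self, mul_zero, eq_comm, mul_eq_zero, or_iff_right hx,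
      Finset.prod_eq_zero_iff] at hprod
    obtain ⟨σ, -, hσ⟩ := hprod
    have hσG : (QuotientGroup.mk σ.1.out : PGL2 K) ∈ G := by
      rw [QuotientGroup.out_eq']; exact σ.2
    have hden := hQ.aeval_mobDen_ne_zero hσG hx
    refine ⟨σ.1.out, hσG, ?_⟩
    rw [mob_some, if_neg hden, Option.some_inj, div_eq_iff hden]
    exact (sub_eq_zero.1 hσ).symm

theorem aeval_denom_ne_zero_of_eq (hQ : IsQuotientMap G g h) {L : Type*} [Field L] [Algebra K L]
    {x α : L} (hx : aeval x g = α * aeval x h) : aeval x h ≠ 0 := fun hh =>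
  hQ.aeval_denom_ne_zero x (by rw [hx, hh, mul_zero]) hh

theorem finite_fibre (hQ : IsQuotientMap G g h) {L : Type*} [Field L] [Algebra K L] (α : L) :
    {x : L | aeval x g = α * aeval x h}.Finite := by
  refine (finite_setOfPred_isRoot (hQ.monic_sub α).ne_zero).subset fun x hx => ?_
  simpa [IsRoot, sub_eq_zero] using hx

theorem ncard_mobOrbit (hQ : IsQuotientMap G g h) [Finite G] {x α : AlgebraicClosure K}
    (hx : aeval x g = α * aeval x h) :
    (mobOrbit G (some x)).ncard =
      {y : AlgebraicClosure K | aeval y g = α * aeval y h}.ncard := by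
  have hh := hQ.aeval_denom_ne_zero_of_eq hx
  rw [hQ.mobOrbit_some_eq hh, Set.ncard_image_of_injective _ (Option.some_injective _), hx,
    mul_div_cancel_right₀ _ hh]

theorem aeval_Qtransform {L : Type*} [Field L] [Algebra K L] (F : K[X]) {x : L}
    (hx : aeval x h ≠ 0) :
    aeval x (Qtransform g h F) =
      aeval x h ^ F.natDegree * aeval (aeval x g / aeval x h) F := by
  rw [aeval_eq_sum_range (p := F), Finset.mul_sum, Qtransform, map_sum]
  refine Finset.sum_congr rfl fun i hi => ?_
  have hi' : i ≤ F.natDegree := Nat.lt_succ_iff.1 (Finset.mem_range.1 hi)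
  rw [map_mul, map_mul, map_pow, map_pow, aeval_C, Algebra.smul_def, div_pow,
    ← Nat.sub_add_cancel hi', pow_add, Nat.add_sub_cancel]
  field_simp

theorem aeval_Qtransform_eq_zero_iff (hQ : IsQuotientMap G g h) {L : Type*} [Field L]
    [Algebra K L] {F : K[X]} (hF : F.Monic) {x : L} :
    aeval x (Qtransform g h F) = 0 ↔ ∃ α : L, aeval α F = 0 ∧ aeval x g = α * aeval x h := by
  constructor
  · intro hx
    have hh : aeval x h ≠ 0 := by
      intro hh
      rw [Qtransform, map_sum, Finset.sum_eq_single_of_mem _ (Finset.self_mem_range_succ _)] at hx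
      · rw [hF.coeff_natDegree, Nat.sub_self, pow_zero, C_1, one_mul, mul_one, map_pow] at hx
        exact hQ.aeval_denom_ne_zero x (eq_zero_of_pow_eq_zero hx) hh
      · intro i hi hin
        have hi' : F.natDegree - i ≠ 0 := by have := Finset.mem_range.1 hi; omega
        rw [map_mul, map_pow _ h, hh, zero_pow hi', mul_zero]
    rw [aeval_Qtransform F hh, mul_eq_zero, or_iff_right (pow_ne_zero _ hh)] at hx
    exact ⟨_, hx, (div_mul_cancel₀ _ hh).symm⟩
  · rintro ⟨α, hα, hx⟩
    have hh := hQ.aeval_denom_ne_zero_of_eq hx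
    rw [aeval_Qtransform F hh, hx, mul_div_cancel_right₀ _ hh, hα, mul_zero]

end IsQuotientMap

/-- Fibres of a rational function over conjugate points have the same cardinality. -/
theorem ncard_fibre_eq_of_isConjRoot {K L : Type*} [Field K] [Field L] [Algebra K L] [Normal K L]
    (g h : K[X]) {α β : L} (hαβ : IsConjRoot K α β) :
    {x : L | aeval x g = α * aeval x h}.ncard = {x : L | aeval x g = β * aeval x h}.ncard := by
  obtain ⟨σ, hσ⟩ := isConjRoot_iff_exists_algEquiv.1 hαβ
  have hset : {x : L | aeval x g = α * aeval x h} =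
      σ '' {x : L | aeval x g = β * aeval x h} := by
    ext x
    obtain ⟨y, rfl⟩ := σ.surjective x
    rw [σ.injective.mem_set_image, Set.mem_ofPred_eq, Set.mem_ofPred_eq, ← hσ,
      aeval_algHom_apply, aeval_algHom_apply, ← map_mul, σ.injective.eq_iff]
  rw [hset, Set.ncard_image_of_injective _ σ.injective]

theorem orbits_in_roots_same_size {K : Type*} [Field K] (G : Subgroup (PGL2 K))
    (hGfin : (G : Set (PGL2 K)).Finite) (g h : Polynomial K) (hQ : IsQuotientMap G g h)
    (F : Polynomial K) (hF : F.Monic) (hFirr : Irreducible F) :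
    (∀ v w : AlgebraicClosure K, v ∈ rootSetAC (Qtransform g h F) →
        w ∈ rootSetAC (Qtransform g h F) →
        (mobOrbit G (some v)).ncard = (mobOrbit G (some w)).ncard) ∧
    ∀ v : AlgebraicClosure K, v ∈ rootSetAC (Qtransform g h F) →
      (rootSetAC (Qtransform g h F)).ncard =
        (rootSetAC F).ncard * (mobOrbit G (some v)).ncard := by
  have : Finite G := hGfin
  have hconj {α β : AlgebraicClosure K} (hα : aeval α F = 0) (hβ : aeval β F = 0) :
      IsConjRoot K α β := by
    rw [isConjRoot_def, ← minpoly.eq_of_irreducible_of_monic hFirr hα hF,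
      ← minpoly.eq_of_irreducible_of_monic hFirr hβ hF]
  refine ⟨fun v w hv hw => ?_, fun v hv => ?_⟩
  · obtain ⟨α, hα, hvα⟩ := (hQ.aeval_Qtransform_eq_zero_iff hF).1 hv
    obtain ⟨β, hβ, hwβ⟩ := (hQ.aeval_Qtransform_eq_zero_iff hF).1 hw
    rw [hQ.ncard_mobOrbit hvα, hQ.ncard_mobOrbit hwβ,
      ncard_fibre_eq_of_isConjRoot g h (hconj hα hβ)]
  · obtain ⟨α, hα, hvα⟩ := (hQ.aeval_Qtransform_eq_zero_iff hF).1 hv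
    have hRF : (rootSetAC F).Finite := by
      refine (finite_setOfPred_isRoot (hF.map (algebraMap K (AlgebraicClosure K))).ne_zero).subset
        fun x hx => ?_
      simpa [IsRoot, rootSetAC] using hx
    have hunion : rootSetAC (Qtransform g h F) =
        (hRF.toFinset.biUnion fun β => (hQ.finite_fibre β).toFinset :
          Finset (AlgebraicClosure K)) := by
      ext x
      simpa [rootSetAC] using hQ.aeval_Qtransform_eq_zero_iff hF
    rw [hQ.ncard_mobOrbit hvα, hunion, Set.ncard_coe_finset, Finset.card_biUnion,
      Finset.sum_congr rfl (g := fun _ => {y : AlgebraicClosure K |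
        aeval y g = α * aeval y h}.ncard), Finset.sum_const, smul_eq_mul,
      Set.ncard_eq_toFinset_card _ hRF]
    · intro β hβ
      rw [← Set.ncard_eq_toFinset_card _ (hQ.finite_fibre β)]
      exact ncard_fibre_eq_of_isConjRoot g h (hconj (hRF.mem_toFinset.1 hβ) hα)
    · intro β _ γ _ hne
      refine Finset.disjoint_left.2 fun x hxβ hxγ => hne ?_
      rw [Set.Finite.mem_toFinset, Set.mem_ofPred_eq] at hxβ hxγ
      exact mul_right_cancel₀ (hQ.aeval_denom_ne_zero_of_eq hxβ) (hxβ.symm.trans hxγ)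
end
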